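/- For any finite simple graph G with at least one vertex, either G contains a Meyniel obstruction, or G contains a strong stable set, or both. -/

import Mathlib

open SimpleGraph

/-- The set of chords of a closed walk `c` in `G`: edges of `G` joining two
vertices of `c` that are not edges of `c` (i.e. not consecutive on `c`). -/
def SimpleGraph.cycleChords {V : Type*} (G : SimpleGraph V) {u : V} (c : G.Walk u u) :
    Set (Sym2 V) :=
  {e | e ∈ G.edgeSet ∧ (∀ x ∈ e, x ∈ c.support) ∧ e ∉ c.edges}

/-- A Meyniel obstruction in `G` is an odd cycle of length at least five with
at most one chord. -/
def SimpleGraph.HasMeynielObstruction {V : Type*} (G : SimpleGraph V) : Prop :=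
  ∃ (u : V) (c : G.Walk u u), c.IsCycle ∧ Odd c.length ∧ 5 ≤ c.length ∧
    (G.cycleChords c).ncard ≤ 1

/-- A stable (independent) set: a set of pairwise nonadjacent vertices. -/
def SimpleGraph.IsStableSet {V : Type*} (G : SimpleGraph V) (S : Set V) : Prop :=
  S.Pairwise fun a b => ¬ G.Adj a b

/-- A strong stable set: a stable set meeting every inclusion-maximal clique. -/
def SimpleGraph.IsStrongStableSet {V : Type*} (G : SimpleGraph V) (S : Set V) : Prop :=
  G.IsStableSet S ∧
    ∀ Q : Set V, G.IsClique Q → (∀ Q' : Set V, G.IsClique Q' → Q ⊆ Q' → Q' = Q) →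
      (S ∩ Q).Nonempty

namespace Meyn

structure CycObs {α : Type*} (H : SimpleGraph α) (n : ℕ) (c : ℕ → α) (x y : ℕ) : Prop where
  odd : Odd n
  five : 5 ≤ n
  inj : ∀ i j, i < j → j < n → c i ≠ c j
  step : ∀ i, i + 1 < n → H.Adj (c i) (c (i+1))
  close : H.Adj (c 0) (c (n-1))
  xy : x < y
  yn : y < n
  chord : ∀ i j, i < j → j < n → H.Adj (c i) (c j) →
    j = i + 1 ∨ (i = 0 ∧ j = n - 1) ∨ (i = x ∧ j = y)

def Free {α : Type*} (H : SimpleGraph α) (o : α) : Prop :=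
  ∀ n c x y, CycObs H n c x y → (∀ i, 1 ≤ i → i < n → c i ≠ o) → (c 0 = o → x ≠ 0) → False

lemma exists_walk {α : Type*} (H : SimpleGraph α) (c : ℕ → α) (n : ℕ)
    (h : ∀ i, i < n → H.Adj (c i) (c (i+1))) :
    ∃ p : H.Walk (c 0) (c n), p.support = (List.range (n+1)).map c ∧
      p.edges = (List.range n).map (fun i => s(c i, c (i+1))) := by
  induction n with
  | zero => exact ⟨Walk.nil, by simp, by simp⟩
  | succ k ih =>
    obtain ⟨p, hp, he⟩ := ih (fun i hi => h i (by omega))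
    refine ⟨p.concat (h k (by omega)), ?_, ?_⟩
    · rw [Walk.support_concat, hp, List.range_succ (n := k+1), List.map_append]; simp
    · rw [Walk.edges_concat, he, List.range_succ (n := k), List.map_append]; simp

lemma obs_of_cyc {V : Type*} (G : SimpleGraph V) {n : ℕ} {c : ℕ → V} {x y : ℕ}
    (h : CycObs G n c x y) : G.HasMeynielObstruction := by
  classical
  obtain ⟨m, rfl⟩ : ∃ m, n = m + 1 := ⟨n-1, by have := h.five; omega⟩
  have h5 := h.five
  obtain ⟨p, hs, he⟩ := exists_walk G c m (fun i hi => h.step i (by omega))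
  have hinj : ∀ i j, i < m + 1 → j < m + 1 → c i = c j → i = j := by
    intro i j hi hj hc
    rcases lt_trichotomy i j with hl | hl | hl
    · exact absurd hc (h.inj i j hl hj)
    · exact hl
    · exact absurd hc.symm (h.inj j i hl hi)
  have hlen : p.length = m := by
    have := p.length_support; rw [hs] at this; simpa using this.symm
  have hcl : G.Adj (c m) (c 0) := by simpa using h.close.symm
  refine ⟨c m, Walk.cons hcl p, ?_, ?_, ?_, ?_⟩
  · rw [Walk.cons_isCycle_iff]
    constructor
    · rw [Walk.isPath_def, hs]
      refine List.Nodup.map_on ?_ List.nodup_range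
      intro i hi j hj
      simp only [List.mem_range] at hi hj
      exact hinj i j hi hj
    · rw [he]
      simp only [List.mem_map, List.mem_range, Sym2.eq_iff, not_exists, not_and]
      intro i hi
      rintro (⟨h1, h2⟩ | ⟨h1, h2⟩)
      · have := hinj _ _ (by omega) (by omega) h1; omega
      · have := hinj _ _ (by omega) (by omega) h1
        have := hinj _ _ (by omega) (by omega) h2; omega
  · rw [Walk.length_cons, hlen]; exact h.odd
  · rw [Walk.length_cons, hlen]; exact h.five
  · have : G.cycleChords (Walk.cons hcl p) ⊆ {s(c x, c y)} := by
      rintro e ⟨h1, h2, h3⟩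
      induction e using Sym2.ind with
      | _ u v =>
      have hmem : ∀ z, z ∈ (Walk.cons hcl p).support → ∃ i, i < m + 1 ∧ c i = z := by
        intro z hz
        rw [Walk.support_cons, List.mem_cons, hs] at hz
        rcases hz with rfl | hz
        · exact ⟨m, by omega, rfl⟩
        · simpa using hz
      obtain ⟨i, hi, rfl⟩ := hmem u (h2 u (by simp))
      obtain ⟨j, hj, rfl⟩ := hmem v (h2 v (by simp))
      rw [SimpleGraph.mem_edgeSet] at h1
      rw [Walk.edges_cons, he] at h3
      simp only [List.mem_cons, List.mem_map, List.mem_range, not_or, not_exists, not_and] at h3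
      obtain ⟨h3, h4⟩ := h3
      rcases lt_trichotomy i j with hl | rfl | hl
      · rcases h.chord i j hl hj h1 with rfl | ⟨rfl, hh⟩ | ⟨rfl, rfl⟩
        · exact absurd rfl (h4 i (by omega))
        · obtain rfl : j = m := by omega
          exact absurd Sym2.eq_swap h3
        · rfl
      · exact absurd h1 (G.irrefl)
      · rcases h.chord j i hl hi h1.symm with rfl | ⟨rfl, hh⟩ | ⟨rfl, rfl⟩
        · exact absurd Sym2.eq_swap (h4 j (by omega))
        · obtain rfl : i = m := by omega
          exact absurd rfl h3
        · exact Sym2.eq_swap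
    calc _ ≤ ({s(c x, c y)} : Set (Sym2 V)).ncard := Set.ncard_le_ncard this
      _ = 1 := Set.ncard_singleton _

/-- path plus apex -/
lemma Free.path {α : Type*} {H : SimpleGraph α} {o : α} (hF : Free H o) (v : ℕ → α) (d : α)
    (k l x y : ℕ) (hkl : k + 3 ≤ l) (hodd : Odd (l - k))
    (inj : ∀ i j, k ≤ i → i < j → j ≤ l → v i ≠ v j)
    (hd : ∀ i, k ≤ i → i ≤ l → v i ≠ d)
    (ho : ∀ i, k < i → i ≤ l → v i ≠ o) (hdo : d ≠ o)
    (step : ∀ i, k ≤ i → i < l → H.Adj (v i) (v (i+1)))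
    (hk : H.Adj d (v k)) (hl : H.Adj d (v l))
    (kx : k ≤ x) (xy : x < y) (yl : y ≤ l + 1)
    (chord : ∀ i j, k ≤ i → i < j → j ≤ l → H.Adj (v i) (v j) → j = i + 1 ∨ (i = x ∧ j = y))
    (chd : ∀ i, k < i → i < l → H.Adj d (v i) → i = x ∧ y = l + 1)
    (hx : v k = o → x ≠ k) : False := by
  obtain ⟨c, e1, e2⟩ : ∃ c : ℕ → α, (∀ i, i ≤ l - k → c i = v (k+i)) ∧
      (∀ i, l - k < i → c i = d) :=
    ⟨fun i => if i ≤ l - k then v (k+i) else d, fun i hi => if_pos hi,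
      fun i hi => if_neg (by omega)⟩
  refine hF (l - k + 2) c (x-k) (y-k) ⟨?_, ?_, ?_, ?_, ?_, ?_, ?_, ?_⟩ ?_ ?_
  · exact hodd.add_even (by decide)
  · omega
  · intro i j hij hj
    rw [e1 i (by omega)]
    by_cases h : j ≤ l - k
    · rw [e1 j h]; exact inj _ _ (by omega) (by omega) (by omega)
    · rw [e2 j (by omega)]; exact hd _ (by omega) (by omega)
  · intro i hi
    rw [e1 i (by omega)]
    by_cases h : i + 1 ≤ l - k
    · rw [e1 _ h]; exact step _ (by omega) (by omega)
    · rw [e2 _ (by omega), show k + i = l by omega]; exact hl.symm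
  · rw [e1 0 (by omega), e2 (l - k + 2 - 1) (by omega)]; exact hk.symm
  · omega
  · omega
  · intro i j hij hj
    rw [e1 i (by omega)]
    by_cases h : j ≤ l - k
    · rw [e1 j h]; intro ha
      have := chord _ _ (by omega) (by omega) (by omega) ha
      omega
    · rw [e2 j (by omega)]; intro ha
      by_cases h1 : i = 0
      · right; left; omega
      by_cases h2 : i = l - k
      · left; omega
      have := chd (k+i) (by omega) (by omega) ha.symm
      omega
  · intro i hi hin
    by_cases h : i ≤ l - k
    · rw [e1 i h]; exact ho _ (by omega) (by omega)
    · rw [e2 i (by omega)]; exact hdo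
  · rw [e1 0 (by omega)]; intro h
    have := hx h
    omega

lemma exists_last (P : ℕ → Prop) (a n : ℕ) (han : a ≤ n) (ha : P a) :
    ∃ k, a ≤ k ∧ k ≤ n ∧ P k ∧ ∀ i, k < i → i ≤ n → ¬ P i := by
  induction n, han using Nat.le_induction with
  | base => exact ⟨a, le_rfl, le_rfl, ha, fun i h1 h2 => by omega⟩
  | succ n hn ih =>
    by_cases h : P (n+1)
    · exact ⟨n+1, by omega, le_rfl, h, fun i h1 h2 => by omega⟩
    · obtain ⟨k, h1, h2, h3, h4⟩ := ih
      refine ⟨k, h1, by omega, h3, fun i hi hi' => ?_⟩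
      rcases Nat.lt_or_ge n i with h5 | h5
      · obtain rfl : i = n + 1 := by omega
        exact h
      · exact h4 i hi h5

lemma exists_first (P : ℕ → Prop) (a n : ℕ) (han : a ≤ n) (ha : P n) :
    ∃ k, a ≤ k ∧ k ≤ n ∧ P k ∧ ∀ i, a ≤ i → i < k → ¬ P i := by
  classical
  have hex : ∃ k, a ≤ k ∧ P k := ⟨n, han, ha⟩
  refine ⟨Nat.find hex, (Nat.find_spec hex).1, Nat.find_min' hex ⟨han, ha⟩, (Nat.find_spec hex).2, ?_⟩
  intro i hi hlt hp
  exact Nat.find_min hex hlt ⟨hi, hp⟩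

/-- chordless path data -/
structure CP {α : Type*} (H : SimpleGraph α) (o : α) (v : ℕ → α) (n : ℕ) : Prop where
  inj : ∀ i j, i < j → j ≤ n → v i ≠ v j
  ho : ∀ i, 0 < i → i ≤ n → v i ≠ o
  step : ∀ i, i < n → H.Adj (v i) (v (i+1))
  chord : ∀ i j, i < j → j ≤ n → H.Adj (v i) (v j) → j = i + 1

lemma CP.mono {α : Type*} {H : SimpleGraph α} {o : α} {v : ℕ → α} {n m : ℕ} (h : CP H o v n)
    (hm : m ≤ n) : CP H o v m :=
  ⟨fun i j hij hj => h.inj i j hij (by omega), fun i hi hin => h.ho i hi (by omega),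
   fun i hi => h.step i (by omega), fun i j hij hj => h.chord i j hij (by omega)⟩

lemma fan {α : Type*} {H : SimpleGraph α} {o : α} (hF : Free H o) (v : ℕ → α) (d : α)
    (hdo : d ≠ o) (h0 : H.Adj d (v 0)) (n : ℕ) (h : CP H o v n)
    (hd : ∀ i, i ≤ n → v i ≠ d) (hn : H.Adj d (v n)) :
    (∀ i, i ≤ n → H.Adj d (v i)) ∨ (∀ i, i ≤ n → H.Adj d (v i) → Even i) := by
  induction n using Nat.strong_induction_on with
  | _ n ih =>
  rcases Nat.eq_zero_or_pos n with rfl | hpos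
  · left; intro i hi; obtain rfl : i = 0 := by omega
    exact h0
  obtain ⟨k, -, hk, hak, hkmax⟩ := exists_last (fun i => H.Adj d (v i)) 0 (n-1) (by omega) h0
  have IH := ih k (by omega) (h.mono (by omega)) (fun i hi => hd i (by omega)) hak
  have A : n = k + 1 ∨ Even (n - k) := by
    by_contra hc
    rw [not_or, Nat.not_even_iff_odd] at hc
    obtain ⟨hc1, q, hq⟩ := hc
    exact hF.path v d k n (k+1) (k+2) (by omega) ⟨q, hq⟩
      (fun i j _ => h.inj i j) (fun i _ => hd i) (fun i hi => h.ho i (by omega)) hdo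
      (fun i _ => h.step i) hak hn (by omega) (by omega) (by omega)
      (fun i j _ hij hj ha => Or.inl (h.chord i j hij hj ha))
      (fun i h1 h2 ha => absurd ha (hkmax i h1 (by omega))) (by omega)
  -- one-chord obstruction
  have B : ∀ k', k' < k → H.Adj d (v k') → (∀ i, k' < i → i < k → ¬ H.Adj d (v i)) →
      Odd (n - k') → False := by
    intro k' hk' hak' hmax ⟨q, hq⟩
    refine hF.path v d k' n k (n+1) (by omega) ⟨q, hq⟩
      (fun i j _ => h.inj i j) (fun i _ => hd i) (fun i hi => h.ho i (by omega)) hdo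
      (fun i _ => h.step i) hak' hn (by omega) (by omega) (by omega)
      (fun i j _ hij hj ha => Or.inl (h.chord i j hij hj ha)) ?_ (by omega)
    intro i h1 h2 ha
    refine ⟨?_, rfl⟩
    by_contra hne
    rcases Nat.lt_or_ge i k with h3 | h3
    · exact hmax i h1 h3 ha
    · exact hkmax i (by omega) (by omega) ha
  rcases Nat.eq_zero_or_pos k with rfl | hkpos
  · rcases A with rfl | A
    · left; intro i hi
      rcases Nat.lt_or_ge i 1 with h3 | h3
      · obtain rfl : i = 0 := by omega
        exact h0
      · obtain rfl : i = 0 + 1 := by omega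
        exact hn
    · right; intro i hi ha
      by_cases h3 : i = 0
      · subst h3; exact Even.zero
      by_cases h4 : i = n
      · subst h4; simpa using A
      · exact absurd ha (hkmax i (by omega) (by omega))
  rcases IH with IH | IH
  · rcases A with rfl | A
    · left; intro i hi
      rcases Nat.lt_or_ge k i with h3 | h3
      · obtain rfl : i = k + 1 := by omega
        exact hn
      · exact IH i h3
    · exact (B (k-1) (by omega) (IH _ (by omega)) (fun i h1 h2 => by omega)
        (by obtain ⟨q, hq⟩ := A; exact ⟨q, by omega⟩)).elim
  · obtain ⟨a, ha'⟩ := IH k le_rfl hak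
    rcases A with rfl | A
    · obtain ⟨k', -, hk', hak', hk'max⟩ := exists_last (fun i => H.Adj d (v i)) 0 (k-1) (by omega) h0
      obtain ⟨b, hb⟩ := IH k' (by omega) hak'
      exact (B k' (by omega) hak' (fun i h1 h2 => hk'max i h1 (by omega))
        ⟨a - b, by omega⟩).elim
    · right; intro i hi ha
      rcases Nat.lt_or_ge k i with h3 | h3
      · by_cases h4 : i = n
        · obtain ⟨q, hq⟩ := A; exact ⟨a + q, by omega⟩
        · exact absurd ha (hkmax i h3 (by omega))
      · exact IH i h3 ha

def HW {V : Type*} (G : SimpleGraph V) (W : Set V) : SimpleGraph (Option V) where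
  Adj u v := match u, v with
    | none, none => False
    | none, some b => ∃ w ∈ W, G.Adj w b
    | some a, none => ∃ w ∈ W, G.Adj w a
    | some a, some b => G.Adj a b
  symm := ⟨by
    rintro (_ | a) (_ | b) h
    · exact h
    · exact h
    · exact h
    · exact SimpleGraph.Adj.symm h⟩
  loopless := ⟨by
    rintro (_ | a) h
    · exact h
    · exact G.irrefl h⟩

lemma HW_some {V : Type*} {G : SimpleGraph V} {W : Set V} {a b : V} :
    (HW G W).Adj (some a) (some b) ↔ G.Adj a b := Iff.rfl
lemma HW_none {V : Type*} {G : SimpleGraph V} {W : Set V} {b : V} :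
    (HW G W).Adj none (some b) ↔ ∃ w ∈ W, G.Adj w b := Iff.rfl

lemma HW_congr {V : Type*} {G : SimpleGraph V} {W W' : Set V} {a b : Option V}
    (ha : a ≠ none) (hb : b ≠ none) : (HW G W).Adj a b ↔ (HW G W').Adj a b := by
  cases a <;> cases b <;> first | contradiction | exact Iff.rfl

/-- no obstruction avoiding `none` -/
lemma no_cyc {V : Type*} {G : SimpleGraph V} (hG : ¬ G.HasMeynielObstruction) {W : Set V}
    {n : ℕ} {c : ℕ → Option V} {x y : ℕ} (h : CycObs (HW G W) n c x y)
    (hc : ∀ i, i < n → c i ≠ none) : False := by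
  have h5 := h.five
  obtain ⟨v0, -⟩ := Option.ne_none_iff_exists.1 (hc 0 (by omega))
  obtain ⟨f, hf⟩ : ∃ f : ℕ → V, ∀ i, i < n → c i = some (f i) := by
    refine ⟨fun i => (c i).getD v0, fun i hi => ?_⟩
    obtain ⟨z, hz⟩ := Option.ne_none_iff_exists.1 (hc i hi)
    simp [← hz]
  apply hG
  refine obs_of_cyc G (n := n) (c := f) (x := x) (y := y) ⟨h.odd, h5, ?_, ?_, ?_, h.xy, h.yn, ?_⟩
  · intro i j hij hj he
    apply h.inj i j hij hj
    rw [hf i (by omega), hf j hj, he]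
  · intro i hi
    have := h.step i hi
    rwa [hf i (by omega), hf _ hi] at this
  · have := h.close
    rwa [hf 0 (by omega), hf (n-1) (by omega)] at this
  · intro i j hij hj ha
    apply h.chord i j hij hj
    rw [hf i (by omega), hf j hj]
    exact ha

def Cand {V : Type*} (G : SimpleGraph V) (W : Set V) (s : V) : Prop :=
  s ∉ W ∧ ¬ ∃ w ∈ W, G.Adj w s

structure Greedy {V : Type*} (G : SimpleGraph V) (W : Set V) (s : V) : Prop where
  cand : Cand G W s
  max : ∀ a b, Cand G W b → (∃ w ∈ W, G.Adj w a) → G.Adj a b → ¬ G.Adj a s →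
    ∃ d, (∃ w ∈ W, G.Adj w d) ∧ G.Adj d s ∧ ¬ G.Adj d b

lemma exists_greedy {V : Type*} [Finite V] (G : SimpleGraph V) (W : Set V)
    (h : ∃ s, Cand G W s) : ∃ s, Greedy G W s := by
  classical
  obtain ⟨s, hs, hmax⟩ := Set.exists_max_image {s | Cand G W s}
    (fun s => {a | (∃ w ∈ W, G.Adj w a) ∧ G.Adj a s}.ncard) (Set.toFinite _) h
  refine ⟨s, hs, ?_⟩
  intro a b hb ha hab has
  by_contra hcon
  push Not at hcon
  have := hmax b hb
  have h2 : {a | (∃ w ∈ W, G.Adj w a) ∧ G.Adj a s} ⊂ {a | (∃ w ∈ W, G.Adj w a) ∧ G.Adj a b} := by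
    refine ⟨fun d hd => ⟨hd.1, hcon d hd.1 hd.2⟩, fun hsub => has (hsub ⟨ha, hab⟩).2⟩
  have h3 := Set.ncard_lt_ncard h2 (Set.toFinite _)
  omega

/-- get the vertex d -/
lemma get_d {V : Type*} {G : SimpleGraph V} {W : Set V} {s : V} (hs : Greedy G W s)
    {a b e : Option V} (ha : a ≠ none) (hb : b ≠ none) (he : e ≠ none)
    (h0a : (HW G W).Adj none a) (h0b : ¬ (HW G W).Adj none b) (h0e : ¬ (HW G W).Adj none e)
    (hab : (HW G W).Adj a b) (hbe : (HW G W).Adj b e) (has : ¬ (HW G W).Adj a (some s)) :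
    ∃ d, d ≠ none ∧ (HW G W).Adj d none ∧ (HW G W).Adj d (some s) ∧ ¬ (HW G W).Adj d b := by
  obtain ⟨a, rfl⟩ := Option.ne_none_iff_exists'.1 ha
  obtain ⟨b, rfl⟩ := Option.ne_none_iff_exists'.1 hb
  obtain ⟨e, rfl⟩ := Option.ne_none_iff_exists'.1 he
  obtain ⟨d, h1, h2, h3⟩ := hs.max a b ⟨fun h => h0e ⟨b, h, hbe⟩, h0b⟩ h0a hab has
  exact ⟨some d, by simp, h1, h2, h3⟩

lemma no_chordless {V : Type*} {G : SimpleGraph V} {W : Set V} {s : V} (hs : Greedy G W s)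
    (hF : Free (HW G W) none) (v : ℕ → Option V) (n : ℕ) (hn : Odd n) (h3 : 3 ≤ n)
    (h : CP (HW G W) none v n) (h0 : v 0 = none) (hvn : v n = some s) : False := by
  have n0 : ∀ i, 2 ≤ i → i ≤ n → ¬ (HW G W).Adj none (v i) := by
    intro i hi hin ha
    rw [← h0] at ha
    have := h.chord 0 i (by omega) hin ha
    omega
  have h1s : ¬ (HW G W).Adj (v 1) (some s) := by
    rw [← hvn]; intro ha
    have := h.chord 1 n (by omega) le_rfl ha
    omega
  obtain ⟨d, hd, hd0, hds, hd2⟩ := get_d hs (a := v 1) (b := v 2) (e := v 3)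
    (h.ho 1 (by omega) (by omega)) (h.ho 2 (by omega) (by omega)) (h.ho 3 (by omega) (by omega))
    (by rw [← h0]; exact h.step 0 (by omega)) (n0 2 (by omega) (by omega)) (n0 3 (by omega) (by omega))
    (h.step 1 (by omega)) (h.step 2 (by omega)) h1s
  have hdv : ∀ i, i ≤ n → v i ≠ d := by
    rintro i hi rfl
    rcases Nat.lt_or_ge i 2 with h4 | h4
    · interval_cases i
      · exact hd h0
      · exact h1s hds
    · exact n0 i h4 hi hd0.symm
  rcases fan hF v d hd (by rw [h0]; exact hd0) n h hdv (by rw [hvn]; exact hds) with hall | heven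
  · exact hd2 (hall 2 (by omega))
  · have := heven n le_rfl (by rw [hvn]; exact hds)
    exact (Nat.not_even_iff_odd.2 hn) this

lemma no_short {V : Type*} {G : SimpleGraph V} {W : Set V} {s : V} (hs : Greedy G W s)
    (hF : Free (HW G W) none) (v : ℕ → Option V) (n a : ℕ) (hn : Odd n) (h3 : 5 ≤ n)
    (inj : ∀ i j, i < j → j ≤ n → v i ≠ v j)
    (ho : ∀ i, 0 < i → i ≤ n → v i ≠ none)
    (step : ∀ i, i < n → (HW G W).Adj (v i) (v (i+1)))
    (chord : ∀ i j, i < j → j ≤ n → (HW G W).Adj (v i) (v j) → j = i + 1 ∨ (i = a ∧ j = a + 2))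
    (ha1 : 1 ≤ a) (han : a + 3 ≤ n) (hach : (HW G W).Adj (v a) (v (a+2)))
    (h0 : v 0 = none) (hvn : v n = some s) : False := by
  have n0 : ∀ i, 2 ≤ i → i ≤ n → ¬ (HW G W).Adj none (v i) := by
    intro i hi hin ha
    rw [← h0] at ha
    have := chord 0 i (by omega) hin ha
    omega
  have h1s : ¬ (HW G W).Adj (v 1) (some s) := by
    rw [← hvn]; intro ha
    have := chord 1 n (by omega) le_rfl ha
    omega
  obtain ⟨b, hb1, hb2, hb3, hb4⟩ : ∃ b, (HW G W).Adj (v 1) (v b) ∧ 2 ≤ b ∧ b ≤ 3 ∧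
      ((a = 1 ∧ b = 3) ∨ (2 ≤ a ∧ b = 2)) := by
    by_cases h : a = 1
    · subst h; exact ⟨3, hach, by omega, by omega, by omega⟩
    · exact ⟨2, step 1 (by omega), by omega, by omega, by omega⟩
  obtain ⟨d, hd, hd0, hds, hdb⟩ := get_d hs (a := v 1) (b := v b) (e := v (b+1))
    (ho 1 (by omega) (by omega)) (ho b (by omega) (by omega)) (ho (b+1) (by omega) (by omega))
    (by rw [← h0]; exact step 0 (by omega)) (n0 b (by omega) (by omega)) (n0 (b+1) (by omega) (by omega))
    hb1 (step b (by omega)) h1s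
  have hdv : ∀ i, i ≤ n → v i ≠ d := by
    rintro i hi rfl
    rcases Nat.lt_or_ge i 2 with h4 | h4
    · interval_cases i
      · exact hd h0
      · exact h1s hds
    · exact n0 i h4 hi hd0.symm
  have hd0' : (HW G W).Adj d (v 0) := by rw [h0]; exact hd0
  have hds' : (HW G W).Adj d (v n) := by rw [hvn]; exact hds
  -- the chordless path without `a+1`
  obtain ⟨q, e1, e2⟩ : ∃ q : ℕ → Option V, (∀ i, i ≤ a → q i = v i) ∧
      (∀ i, a < i → q i = v (i+1)) :=
    ⟨fun i => if i ≤ a then v i else v (i+1), fun i hi => if_pos hi,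
      fun i hi => if_neg (by omega)⟩
  have hq : CP (HW G W) none q (n-1) := by
    refine ⟨?_, ?_, ?_, ?_⟩
    · intro i j hij hj
      rcases Nat.lt_or_ge a i with h | h <;> rcases Nat.lt_or_ge a j with h' | h' <;>
        simp only [e1, e2, h, h'] <;> exact inj _ _ (by omega) (by omega)
    · intro i hi hin
      rcases Nat.lt_or_ge a i with h | h <;>
        simp only [e1, e2, h] <;> exact ho _ (by omega) (by omega)
    · intro i hi
      rcases Nat.lt_trichotomy i a with h | h | h
      · rw [e1 i (by omega), e1 (i+1) (by omega)]; exact step _ (by omega)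
      · rw [e1 i (by omega), e2 (i+1) (by omega), h]; exact hach
      · rw [e2 i (by omega), e2 (i+1) (by omega)]; exact step _ (by omega)
    · intro i j hij hj
      rcases Nat.lt_or_ge a i with h | h <;> rcases Nat.lt_or_ge a j with h' | h' <;>
        simp only [e1, e2, h, h'] <;> intro hadj <;>
        have := chord _ _ (by omega) (by omega) hadj <;> omega
  have hdq : ∀ i, i ≤ n - 1 → q i ≠ d := by
    intro i hi
    rcases Nat.lt_or_ge a i with h | h <;>
        simp only [e1, e2, h] <;> exact hdv _ (by omega)
  have hev := fan hF q d hd (by rw [e1 0 (by omega)]; exact hd0') (n-1) hq hdq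
    (by rw [e2 _ (by omega), show n - 1 + 1 = n by omega]; exact hds')
  rcases hev with hall | hev
  · rcases hb4 with ⟨rfl, rfl⟩ | ⟨h2, rfl⟩
    · have := hall 2 (by omega)
      rw [e2 2 (by omega)] at this
      exact hdb this
    · have := hall 2 (by omega)
      rw [e1 2 (by omega)] at this
      exact hdb this
  have ev1 : ∀ i, i ≤ a → (HW G W).Adj d (v i) → Even i := by
    intro i hi hadj
    exact hev i (by omega) (by rw [e1 i hi]; exact hadj)
  have ev2 : ∀ i, a + 2 ≤ i → i ≤ n → (HW G W).Adj d (v i) → Odd i := by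
    intro i hi hin hadj
    have := hev (i-1) (by omega) (by rw [e2 _ (by omega), show i - 1 + 1 = i by omega]; exact hadj)
    obtain ⟨t, ht⟩ := this
    exact ⟨t, by omega⟩
  by_cases hmid : (HW G W).Adj d (v (a+1))
  · rcases Nat.even_or_odd a with hae | hao
    · have hcp : CP (HW G W) none v (a+1) :=
        ⟨fun i j hij hj => inj i j hij (by omega), fun i hi hin => ho i hi (by omega),
          fun i hi => step i (by omega), fun i j hij hj hadj => by
            have := chord i j hij (by omega) hadj
            omega⟩
      rcases fan hF v d hd hd0' (a+1) hcp (fun i hi => hdv i (by omega)) hmid with hh | hh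
      · rcases hb4 with ⟨rfl, rfl⟩ | ⟨h2, rfl⟩
        · exact absurd hae (by decide)
        · exact hdb (hh 2 (by omega))
      · obtain ⟨t, ht⟩ := hae
        obtain ⟨t', ht'⟩ := hh _ le_rfl hmid
        omega
    · have hcp : CP (HW G W) none (fun i => v (a+1+i)) (n-a-1) :=
        ⟨fun i j hij hj => inj _ _ (by omega) (by omega), fun i hi hin => ho _ (by omega) (by omega),
          fun i hi => step (a+1+i) (by omega), fun i j hij hj hadj => by
            have := chord _ _ (by omega) (by omega) hadj
            omega⟩
      have hl : (HW G W).Adj d (v (a+1+(n-a-1))) := by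
        rw [show a+1+(n-a-1) = n by omega]; exact hds'
      obtain ⟨t, ht⟩ := hao
      obtain ⟨t', ht'⟩ := hn
      rcases fan hF _ d hd hmid (n-a-1) hcp (fun i hi => hdv _ (by omega)) hl with hh | hh
      · obtain ⟨t'', ht''⟩ := ev2 (a+1+2) (by omega) (by omega) (hh 2 (by omega))
        omega
      · obtain ⟨t'', ht''⟩ := hh _ le_rfl hl
        omega
  · obtain ⟨k, -, hka, hk, hkmax⟩ := exists_last (fun i => (HW G W).Adj d (v i)) 0 a (by omega) hd0'
    obtain ⟨l, hla, hln, hl, hlmin⟩ :=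
      exists_first (fun i => (HW G W).Adj d (v i)) (a+2) n (by omega) hds'
    obtain ⟨t, ht⟩ := ev1 k hka hk
    obtain ⟨t', ht'⟩ := ev2 l hla hln hl
    refine hF.path v d k l a (a+2) (by omega) ⟨t' - t, by omega⟩
      (fun i j _ hij hj => inj i j hij (by omega)) (fun i _ hi => hdv i (by omega))
      (fun i hi hi' => ho i (by omega) (by omega)) hd (fun i _ hi => step i (by omega)) hk hl
      hka (by omega) (by omega) (fun i j _ hij hj hadj => chord i j hij (by omega) hadj) ?_ ?_
    · intro i h1 h2 hadj
      exfalso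
      rcases Nat.lt_trichotomy i (a+1) with h | h | h
      · exact hkmax i h1 (by omega) hadj
      · subst h; exact hmid hadj
      · exact hlmin i (by omega) h2 hadj
    · intro h h'
      subst h'
      exact ho a (by omega) (by omega) h

lemma no_path {V : Type*} {G : SimpleGraph V} {W : Set V} {s : V} (hs : Greedy G W s)
    (hF : Free (HW G W) none) (v : ℕ → Option V) (n x y : ℕ) (hn : Odd n) (h3 : 5 ≤ n)
    (inj : ∀ i j, i < j → j ≤ n → v i ≠ v j)
    (ho : ∀ i, 0 < i → i ≤ n → v i ≠ none)
    (step : ∀ i, i < n → (HW G W).Adj (v i) (v (i+1)))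
    (chord : ∀ i j, i < j → j ≤ n → (HW G W).Adj (v i) (v j) → j = i + 1 ∨ (i = x ∧ j = y))
    (hx1 : 1 ≤ x) (hxy : x < y) (hyn : y < n)
    (h0 : v 0 = none) (hvn : v n = some s) : False := by
  by_cases hch : (HW G W).Adj (v x) (v y)
  swap
  · refine no_chordless hs hF v n hn (by omega) ⟨inj, ho, step, ?_⟩ h0 hvn
    intro i j hij hj hadj
    rcases chord i j hij hj hadj with h | ⟨rfl, rfl⟩
    · exact h
    · exact absurd hadj hch
  rcases Nat.even_or_odd (y - x) with ⟨t, ht⟩ | ⟨t, ht⟩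
  · by_cases h2 : y = x + 2
    · subst h2
      exact no_short hs hF v n x hn h3 inj ho step chord hx1 (by omega) hch h0 hvn
    · refine hF (y - x + 1) (fun i => v (x + i)) 1 2 ⟨⟨t, by omega⟩, by omega,
        fun i j hij hj => inj _ _ (by omega) (by omega), fun i hi => step (x+i) (by omega), ?_,
        by omega, by omega, ?_⟩ (fun i hi hin => ho _ (by omega) (by omega)) (by omega)
      · show (HW G W).Adj (v (x+0)) (v (x + (y - x + 1 - 1)))
        rw [show x + (y - x + 1 - 1) = y by omega]; exact hch
      · intro i j hij hj hadj
        have := chord _ _ (by omega) (by omega) hadj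
        omega
  · obtain ⟨q, e1, e2⟩ : ∃ q : ℕ → Option V, (∀ i, i ≤ x → q i = v i) ∧
      (∀ i, x < i → q i = v (i+(y-x-1))) :=
      ⟨fun i => if i ≤ x then v i else v (i+(y-x-1)), fun i hi => if_pos hi,
        fun i hi => if_neg (by omega)⟩
    obtain ⟨t', ht'⟩ := hn
    refine no_chordless hs hF q (n - (y-x-1)) ⟨t' - t, by omega⟩ (by omega) ⟨?_, ?_, ?_, ?_⟩ ?_ ?_
    · intro i j hij hj
      rcases Nat.lt_or_ge x i with h | h <;> rcases Nat.lt_or_ge x j with h' | h' <;>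
        simp only [e1, e2, h, h'] <;> exact inj _ _ (by omega) (by omega)
    · intro i hi hin
      rcases Nat.lt_or_ge x i with h | h <;>
        simp only [e1, e2, h] <;> exact ho _ (by omega) (by omega)
    · intro i hi
      rcases Nat.lt_trichotomy i x with h | h | h
      · rw [e1 i (by omega), e1 (i+1) (by omega)]; exact step _ (by omega)
      · rw [e1 i (by omega), e2 (i+1) (by omega), h, show x + 1 + (y-x-1) = y by omega]; exact hch
      · rw [e2 i (by omega), e2 (i+1) (by omega), show i + 1 + (y-x-1) = i + (y-x-1) + 1 by omega]
        exact step _ (by omega)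
    · intro i j hij hj
      rcases Nat.lt_or_ge x i with h | h <;> rcases Nat.lt_or_ge x j with h' | h' <;>
        simp only [e1, e2, h, h'] <;> intro hadj <;>
        have := chord _ _ (by omega) (by omega) hadj <;> omega
    · rw [e1 0 (by omega), h0]
    · rw [e2 _ (by omega), show n - (y-x-1) + (y-x-1) = n by omega, hvn]

lemma HW_insert {V : Type*} {G : SimpleGraph V} {W : Set V} {s : V} {a : Option V} (ha : a ≠ none) :
    (HW G (insert s W)).Adj none a ↔ (HW G W).Adj none a ∨ (HW G W).Adj (some s) a := by
  obtain ⟨a, rfl⟩ := Option.ne_none_iff_exists'.1 ha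
  simp [HW_none, HW_some, or_comm]

/-- The main case, after orientation. -/
lemma main_case {V : Type*} {G : SimpleGraph V} {W : Set V} {s : V} (hs : Greedy G W s)
    (hF : Free (HW G W) none) {n : ℕ} {c : ℕ → Option V} {x y : ℕ}
    (h : CycObs (HW G (insert s W)) n c x y) (hc : ∀ i, 1 ≤ i → i < n → c i ≠ none)
    (h0 : c 0 = none) (hx : x ≠ 0) (hsc : ∀ i, i < n → c i ≠ some s)
    (h1 : (HW G W).Adj none (c 1)) (h1s : ¬ (HW G W).Adj (some s) (c 1))
    (hl : ¬ (HW G W).Adj none (c (n-1))) (hls : (HW G W).Adj (some s) (c (n-1))) : False := by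
  have h5 := h.five
  obtain ⟨v, e1, e2⟩ : ∃ q : ℕ → Option V, (∀ i, i < n → q i = c i) ∧ q n = some s :=
      ⟨fun i => if i < n then c i else some s, fun i hi => if_pos hi, if_neg (by omega)⟩
  have hmid : ∀ i, 2 ≤ i → i < n - 1 → ¬ (HW G W).Adj none (c i) ∧ ¬ (HW G W).Adj (some s) (c i) := by
    intro i hi hin
    have : ¬ (HW G (insert s W)).Adj (c 0) (c i) := by
      intro hadj
      have := h.chord 0 i (by omega) (by omega) hadj
      omega
    rw [h0, HW_insert (hc i (by omega) (by omega))] at this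
    tauto
  have hxy := h.xy
  have hyn := h.yn
  refine no_path hs hF v n x y h.odd h5 ?_ ?_ ?_ ?_ (by omega) h.xy h.yn
    (by rw [e1 0 (by omega), h0]) e2
  · intro i j hij hj
    rw [e1 i (by omega)]
    by_cases hjn : j = n
    · rw [hjn, e2]; exact hsc i (by omega)
    · rw [e1 j (by omega)]; exact h.inj i j hij (by omega)
  · intro i hi hin
    by_cases hjn : i = n
    · rw [hjn, e2]; simp
    · rw [e1 i (by omega)]; exact hc i (by omega) (by omega)
  · intro i hi
    rw [e1 i hi]
    by_cases hjn : i + 1 = n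
    · rw [hjn, e2, show i = n - 1 by omega]; exact hls.symm
    · rw [e1 _ (by omega)]
      by_cases hi0 : i = 0
      · subst hi0; rw [h0]; exact h1
      · rw [HW_congr (hc i (by omega) hi) (hc (i+1) (by omega) (by omega))]
        exact h.step i (by omega)
  · intro i j hij hj
    rw [e1 i (by omega)]
    by_cases hjn : j = n
    · rw [hjn, e2]
      intro hadj
      left
      by_contra hne
      by_cases hi0 : i = 0
      · subst hi0; rw [h0] at hadj; exact hs.cand.2 hadj
      by_cases hi1 : i = 1
      · subst hi1; exact h1s hadj.symm
      · exact (hmid i (by omega) (by omega)).2 hadj.symm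
    · rw [e1 j (by omega)]
      intro hadj
      by_cases hi0 : i = 0
      · left
        subst hi0; rw [h0] at hadj
        by_contra hne
        by_cases hjl : j = n - 1
        · subst hjl; exact hl hadj
        · exact (hmid j (by omega) (by omega)).1 hadj
      · rw [HW_congr (hc i (by omega) (by omega)) (hc j (by omega) (by omega))] at hadj
        have := h.chord i j hij (by omega) hadj
        omega

lemma CycObs.reverse {α : Type*} {H : SimpleGraph α} {n : ℕ} {c c' : ℕ → α} {x y : ℕ}
    (h : CycObs H n c x y) (hx : x ≠ 0) (h0 : c' 0 = c 0)
    (hc : ∀ i, 1 ≤ i → c' i = c (n - i)) : CycObs H n c' (n-y) (n-x) := by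
  have h5 := h.five
  have hxy := h.xy
  have hyn := h.yn
  refine ⟨h.odd, h5, ?_, ?_, ?_, by omega, by omega, ?_⟩
  · intro i j hij hj
    rw [hc j (by omega)]
    by_cases hi : i = 0
    · rw [hi, h0]; exact h.inj _ _ (by omega) (by omega)
    · rw [hc i (by omega)]; exact (h.inj _ _ (by omega) (by omega)).symm
  · intro i hi
    rw [hc (i+1) (by omega)]
    by_cases hi : i = 0
    · rw [hi, h0]; exact h.close
    · rw [hc i (by omega)]
      have := h.step (n - (i+1)) (by omega)
      rw [show n - (i+1) + 1 = n - i by omega] at this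
      exact this.symm
  · rw [h0, hc _ (by omega), show n - (n-1) = 0 + 1 by omega]
    exact h.step 0 (by omega)
  · intro i j hij hj
    rw [hc j (by omega)]
    by_cases hi : i = 0
    · rw [hi, h0]; intro hadj
      have := h.chord _ _ (by omega) (by omega) hadj
      omega
    · rw [hc i (by omega)]; intro hadj
      have := h.chord _ _ (by omega) (by omega) hadj.symm
      omega

lemma free_step {V : Type*} {G : SimpleGraph V} (hG : ¬ G.HasMeynielObstruction)
    {W : Set V} {s : V} (hs : Greedy G W s)
    (hF : Free (HW G W) none) : Free (HW G (insert s W)) none := by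
  intro n c x y h hc hx
  by_cases h0 : c 0 = none
  swap
  · refine no_cyc hG h (fun i hi => ?_)
    rcases Nat.eq_zero_or_pos i with rfl | hp
    · exact h0
    · exact hc i hp hi
  have hx := hx h0
  have h5 := h.five
  have hmid : ∀ i, 2 ≤ i → i < n - 1 → ¬ (HW G W).Adj none (c i) ∧ ¬ (HW G W).Adj (some s) (c i) := by
    intro i hi hin
    have : ¬ (HW G (insert s W)).Adj (c 0) (c i) := by
      intro hadj
      have := h.chord 0 i (by omega) (by omega) hadj
      omega
    rw [h0, HW_insert (hc i (by omega) (by omega))] at this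
    tauto
  have hsc : ∀ i, i < n → c i ≠ some s := by
    intro i hi he
    have hi0 : i ≠ 0 := by rintro rfl; rw [h0] at he; simp at he
    rcases Nat.lt_or_ge i (n-2) with h' | h'
    · have := h.step i (by omega)
      rw [HW_congr (W' := W) (hc i (by omega) hi) (hc (i+1) (by omega) (by omega)), he] at this
      exact (hmid (i+1) (by omega) (by omega)).2 this
    · have := h.step (i-1) (by omega)
      rw [show i - 1 + 1 = i by omega,
        HW_congr (W' := W) (hc (i-1) (by omega) (by omega)) (hc i (by omega) hi), he] at this
      exact (hmid (i-1) (by omega) (by omega)).2 this.symm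
  have d1 : (HW G W).Adj none (c 1) ∨ (HW G W).Adj (some s) (c 1) := by
    rw [← HW_insert (hc 1 (by omega) (by omega)), ← h0]; exact h.step 0 (by omega)
  have d2 : (HW G W).Adj none (c (n-1)) ∨ (HW G W).Adj (some s) (c (n-1)) := by
    rw [← HW_insert (hc (n-1) (by omega) (by omega)), ← h0]; exact h.close
  -- replacing the apex
  have key : ∀ z, (∀ i, 1 ≤ i → i < n → z ≠ c i) → (HW G W).Adj z (c 1) → (HW G W).Adj z (c (n-1)) →
      (∀ i, 2 ≤ i → i < n - 1 → ¬ (HW G W).Adj z (c i)) → False := by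
    intro z hz hz1 hz2 hz3
    obtain ⟨q, e1, e2⟩ : ∃ q : ℕ → Option V, (∀ i, 1 ≤ i → q i = c i) ∧ q 0 = z :=
      ⟨fun i => if 1 ≤ i then c i else z, fun i hi => if_pos hi, if_neg (by omega)⟩
    refine hF n q x y ⟨h.odd, h5, ?_, ?_, ?_, h.xy, h.yn, ?_⟩ ?_ (fun _ => hx)
    · intro i j hij hj
      rw [e1 j (by omega)]
      by_cases hi : i = 0
      · rw [hi, e2]; exact hz j (by omega) hj
      · rw [e1 i (by omega)]; exact h.inj i j hij hj
    · intro i hi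
      rw [e1 (i+1) (by omega)]
      by_cases hi : i = 0
      · rw [hi, e2]; exact hz1
      · rw [e1 i (by omega), HW_congr (hc i (by omega) (by omega)) (hc (i+1) (by omega) (by omega))]
        exact h.step i (by omega)
    · rw [e2, e1 _ (by omega)]; exact hz2
    · intro i j hij hj
      rw [e1 j (by omega)]
      by_cases hi : i = 0
      · rw [hi, e2]; intro hadj
        by_contra hne
        exact hz3 j (by omega) (by omega) hadj
      · rw [e1 i (by omega), HW_congr (hc i (by omega) (by omega)) (hc j (by omega) (by omega))]
        exact h.chord i j hij hj
    · intro i hi hin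
      rw [e1 i hi]; exact hc i hi hin
  by_cases a1 : (HW G W).Adj none (c 1) <;> by_cases a2 : (HW G W).Adj none (c (n-1))
  · exact key none (fun i hi hin => (hc i hi hin).symm) a1 a2 (fun i hi hin => (hmid i hi hin).1)
  · have b2 := d2.resolve_left a2
    by_cases b1 : (HW G W).Adj (some s) (c 1)
    · exact key (some s) (fun i hi hin => (hsc i hin).symm) b1 b2 (fun i hi hin => (hmid i hi hin).2)
    · exact main_case hs hF h hc h0 hx hsc a1 b1 a2 b2
  · have b1 := d1.resolve_left a1
    by_cases b2 : (HW G W).Adj (some s) (c (n-1))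
    · exact key (some s) (fun i hi hin => (hsc i hin).symm) b1 b2 (fun i hi hin => (hmid i hi hin).2)
    · obtain ⟨q, e1, e2⟩ : ∃ q : ℕ → Option V, (∀ i, 1 ≤ i → q i = c (n-i)) ∧ q 0 = c 0 :=
        ⟨fun i => if 1 ≤ i then c (n-i) else c 0, fun i hi => if_pos hi, if_neg (by omega)⟩
      have hyn := h.yn
      refine main_case hs hF (h.reverse hx e2 e1) ?_ (by rw [e2, h0]) (by omega) ?_ ?_ ?_ ?_ ?_
      · intro i hi hin; rw [e1 i hi]; exact hc _ (by omega) (by omega)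
      · intro i hi
        by_cases hi0 : i = 0
        · rw [hi0, e2]; exact hsc 0 (by omega)
        · rw [e1 i (by omega)]; exact hsc _ (by omega)
      · rw [e1 1 le_rfl]; exact a2
      · rw [e1 1 le_rfl]; exact b2
      · rw [e1 _ (by omega), show n - (n-1) = 1 by omega]; exact a1
      · rw [e1 _ (by omega), show n - (n-1) = 1 by omega]; exact b1
  · exact key (some s) (fun i hi hin => (hsc i hin).symm) (d1.resolve_left a1) (d2.resolve_left a2)
      (fun i hi hin => (hmid i hi hin).2)

lemma nice {V : Type*} {G : SimpleGraph V} {W : Set V} {s : V} (hs : Greedy G W s)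
    (hF : Free (HW G W) none) {b a : V} (hb : ∃ w ∈ W, G.Adj w b) (ha : ¬ ∃ w ∈ W, G.Adj w a)
    (hba : G.Adj b a) (has : G.Adj a s) (hbs : ¬ G.Adj b s) : False := by
  have hne : b ≠ s := by rintro rfl; exact hs.cand.2 hb
  refine no_chordless hs hF (fun i => if i = 0 then none else if i = 1 then some b else
    if i = 2 then some a else some s) 3 (by decide) le_rfl ⟨?_, ?_, ?_, ?_⟩ rfl rfl
  · intro i j hij hj
    have := hba.ne
    have := has.ne
    interval_cases j <;> interval_cases i <;> simp_all
  · intro i hi hin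
    interval_cases i <;> simp
  · intro i hi
    interval_cases i
    · exact hb
    · exact hba
    · exact has
  · intro i j hij hj hadj
    interval_cases j <;> interval_cases i <;> first | rfl | exfalso
    · exact ha hadj
    · exact hs.cand.2 hadj
    · exact hbs hadj

structure Good {V : Type*} (G : SimpleGraph V) (W : Set V) : Prop where
  stable : G.IsStableSet W
  free : Free (HW G W) none
  clique : ∀ Q : Set V, G.IsClique Q → Q.Nonempty → (∀ q ∈ Q, ∃ w ∈ W, G.Adj w q) →
    ∃ w ∈ W, ∀ q ∈ Q, G.Adj w q

lemma good_empty {V : Type*} {G : SimpleGraph V} (hG : ¬ G.HasMeynielObstruction) :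
    Good G ∅ := by
  refine ⟨by simp [IsStableSet], ?_, ?_⟩
  · intro n c x y h hc hx
    refine no_cyc hG h (fun i hi => ?_)
    have h5 := h.five
    rcases Nat.eq_zero_or_pos i with rfl | hp
    · intro h0
      have := h.step 0 (by omega)
      obtain ⟨a, ha⟩ := Option.ne_none_iff_exists'.1 (hc (0+1) (by omega) (by omega))
      rw [h0, ha, HW_none] at this
      simp at this
    · exact hc i hp hi
  · rintro Q - ⟨q, hq⟩ h
    obtain ⟨w, hw, -⟩ := h q hq
    exact hw.elim

lemma good_step {V : Type*} {G : SimpleGraph V} (hG : ¬ G.HasMeynielObstruction)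
    {W : Set V} {s : V} (hs : Greedy G W s) (hW : Good G W) : Good G (insert s W) := by
  refine ⟨?_, free_step hG hs hW.free, ?_⟩
  · intro a ha b hb hab hadj
    rcases ha with rfl | ha <;> rcases hb with rfl | hb
    · exact hab rfl
    · exact hs.cand.2 ⟨b, hb, hadj.symm⟩
    · exact hs.cand.2 ⟨a, ha, hadj⟩
    · exact hW.stable ha hb hab hadj
  · intro Q hQ hne h
    by_cases hall : ∀ q ∈ Q, ∃ w ∈ W, G.Adj w q
    · obtain ⟨w, hw, hh⟩ := hW.clique Q hQ hne hall
      exact ⟨w, Or.inr hw, hh⟩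
    · refine ⟨s, Or.inl rfl, ?_⟩
      by_contra hcon
      push Not at hcon
      obtain ⟨b, hbQ, hbs⟩ := hcon
      obtain ⟨a, haQ, ha⟩ := by simpa only [not_forall] using hall
      have key : ∀ q ∈ Q, (¬ ∃ w ∈ W, G.Adj w q) → G.Adj s q := by
        intro q hq hn
        obtain ⟨w, hw, hadj⟩ := h q hq
        rcases hw with rfl | hw
        · exact hadj
        · exact absurd ⟨w, hw, hadj⟩ hn
      have has := key a haQ ha
      have hb : ∃ w ∈ W, G.Adj w b := by
        by_contra hb
        exact hbs (key b hbQ hb)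
      have hne : b ≠ a := by rintro rfl; exact hbs has
      exact nice hs hW.free hb ha (hQ hbQ haQ hne) has.symm (fun h => hbs h.symm)

end Meyn

/-- For any graph with at least one vertex, either `G` contains a Meyniel
obstruction, or `G` contains a strong stable set (or both). -/
theorem hasMeynielObstruction_or_exists_strongStableSet {V : Type*} [Fintype V] [Nonempty V]
    (G : SimpleGraph V) :
    G.HasMeynielObstruction ∨ ∃ S : Set V, G.IsStrongStableSet S := by
  classical
  by_cases hG : G.HasMeynielObstruction
  · exact Or.inl hG
  right
  obtain ⟨W, hW⟩ := (Set.toFinite {W : Set V | Meyn.Good G W}).exists_maximal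
    ⟨∅, Meyn.good_empty hG⟩
  have hgood : Meyn.Good G W := hW.prop
  have hT : ∀ s, ¬ Meyn.Cand G W s := by
    intro s hs
    obtain ⟨s, hs⟩ := Meyn.exists_greedy G W ⟨s, hs⟩
    have h1 : Meyn.Good G (insert s W) := Meyn.good_step hG hs hgood
    have h2 := hW.le_of_ge h1 (Set.subset_insert s W)
    exact hs.cand.1 (h2 (Set.mem_insert s W))
  refine ⟨W, hgood.stable, ?_⟩
  intro Q hQ hmax
  by_contra hne
  have hdis : ∀ q ∈ Q, q ∉ W := fun q hq hw => hne ⟨q, hw, hq⟩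
  have hQne : Q.Nonempty := by
    by_contra he
    rw [Set.not_nonempty_iff_eq_empty] at he
    subst he
    obtain ⟨v⟩ := (inferInstance : Nonempty V)
    have := hmax {v} (by simp) (by simp)
    simp at this
  obtain ⟨w, hw, hall⟩ := hgood.clique Q hQ hQne (by
    intro q hq
    by_contra hcon
    exact hT q ⟨hdis q hq, hcon⟩)
  have hins : insert w Q = Q := hmax _ (hQ.insert (fun b hb _ => hall b hb)) (Set.subset_insert w Q)
  exact hdis w (hins ▸ Set.mem_insert w Q) hw
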